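/- arXiv:math/9812121 — 3 statements merged into one kernel-verified Lean document; each statement's English description precedes it below -/
import Mathlib

section
/- A homogeneous polynomial q ∈ S of degree 2 satisfies Δ₁ q = Δ₂ q = Δ₃ q = 0 if and only if q is a ℂ-linear combination of the seven quadrics f₀, …, f₆; moreover f₀, …, f₆ are linearly independent, so this kernel is a 7-dimensional subspace of the 10-dimensional space of quadrics. -/
noncomputable section

open MvPolynomial

/-- Δ₁ = ∂²/∂u₀∂u₁ − (1/2)∂²/∂u₂². -/
noncomputable def Δ₁ (q : MvPolynomial (Fin 4) ℂ) : MvPolynomial (Fin 4) ℂ :=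
  pderiv 0 (pderiv 1 q) - ((1 : ℂ) / 2) • pderiv 2 (pderiv 2 q)

/-- Δ₂ = ∂²/∂u₀∂u₂ − (1/2)∂²/∂u₃². -/
noncomputable def Δ₂ (q : MvPolynomial (Fin 4) ℂ) : MvPolynomial (Fin 4) ℂ :=
  pderiv 0 (pderiv 2 q) - ((1 : ℂ) / 2) • pderiv 3 (pderiv 3 q)

/-- Δ₃ = ∂²/∂u₀∂u₃ − (1/2)∂²/∂u₁². -/
noncomputable def Δ₃ (q : MvPolynomial (Fin 4) ℂ) : MvPolynomial (Fin 4) ℂ :=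
  pderiv 0 (pderiv 3 q) - ((1 : ℂ) / 2) • pderiv 1 (pderiv 1 q)

noncomputable def f₀ : MvPolynomial (Fin 4) ℂ := X 0 ^ 2
noncomputable def f₁ : MvPolynomial (Fin 4) ℂ := X 2 * X 3
noncomputable def f₂ : MvPolynomial (Fin 4) ℂ := X 3 * X 1
noncomputable def f₃ : MvPolynomial (Fin 4) ℂ := X 1 * X 2
noncomputable def f₄ : MvPolynomial (Fin 4) ℂ := X 0 * X 3 + X 1 ^ 2
noncomputable def f₅ : MvPolynomial (Fin 4) ℂ := X 0 * X 1 + X 2 ^ 2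
noncomputable def f₆ : MvPolynomial (Fin 4) ℂ := X 0 * X 2 + X 3 ^ 2

lemma const_of_hom (q : MvPolynomial (Fin 4) ℂ) (hq : q.IsHomogeneous 2) (i j : Fin 4) :
    ∃ c : ℂ, pderiv i (pderiv j q) = C c := by
  have h : (pderiv i (pderiv j q)).IsHomogeneous 0 := (hq.pderiv (i := j)).pderiv (i := i)
  exact ⟨_, totalDegree_eq_zero_iff_eq_C.mp ((totalDegree_zero_iff_isHomogeneous _).mpr h)⟩

lemma pderiv_swap (q : MvPolynomial (Fin 4) ℂ) (i j : Fin 4) :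
    pderiv i (pderiv j q) = pderiv j (pderiv i q) := by
  have h : ⁅(pderiv i : Derivation ℂ (MvPolynomial (Fin 4) ℂ) (MvPolynomial (Fin 4) ℂ)),
      (pderiv j : Derivation ℂ (MvPolynomial (Fin 4) ℂ) (MvPolynomial (Fin 4) ℂ))⁆ = 0 := by
    apply MvPolynomial.derivation_ext
    intro k
    simp only [Derivation.commutator_apply, pderiv_X, Derivation.zero_apply]
    by_cases h1 : j = k <;> by_cases h2 : i = k <;> simp [Pi.single_apply, h1, h2, eq_comm] 
  have := congrArg (fun D => D q) h
  simpa [Derivation.commutator_apply, sub_eq_zero] using this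

lemma quad_expand (q : MvPolynomial (Fin 4) ℂ) (hq : q.IsHomogeneous 2) :
    C 2 * q = ∑ i, X i * ∑ j, X j * pderiv j (pderiv i q) := by
  have h2 := hq.sum_X_mul_pderiv
  have h1 : ∀ i, ∑ j, X j * pderiv j (pderiv i q) = pderiv i q := by
    intro i
    have := (hq.pderiv (i := i)).sum_X_mul_pderiv
    simpa using this
  simp only [h1, h2]
  rw [← smul_eq_C_mul, nsmul_eq_mul, smul_eq_C_mul, map_ofNat C 2]
  norm_num

lemma lin_indep : LinearIndependent ℂ ![f₀, f₁, f₂, f₃, f₄, f₅, f₆] := by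
  rw [Fintype.linearIndependent_iff]
  intro g hg
  have ev : ∀ x : Fin 4 → ℂ, _ := fun x => congrArg (eval x) hg
  simp only [Fin.sum_univ_succ, f₀, f₁, f₂, f₃, f₄, f₅, f₆] at ev
  have e0 := ev ![1,0,0,0]
  have e1 := ev ![0,1,0,0]
  have e2 := ev ![0,0,1,0]
  have e3 := ev ![0,0,0,1]
  have e4 := ev ![0,1,1,0]
  have e5 := ev ![0,0,1,1]
  have e6 := ev ![0,1,0,1]
  simp [smul_eval] at e0 e1 e2 e3 e4 e5 e6
  simp [e0, e1, e2, e3] at e4 e5 e6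
  intro i
  fin_cases i <;> simp_all

/-- a quadric q satisfies Δ₁q = Δ₂q = Δ₃q = 0 iff q is a linear
combination of f₀, …, f₆; moreover f₀, …, f₆ are linearly independent, so the
kernel is a 7-dimensional space of quadrics. -/
theorem kernel_of_Deltas :
    (∀ q : MvPolynomial (Fin 4) ℂ, q.IsHomogeneous 2 →
      ((Δ₁ q = 0 ∧ Δ₂ q = 0 ∧ Δ₃ q = 0) ↔
        q ∈ Submodule.span ℂ ({f₀, f₁, f₂, f₃, f₄, f₅, f₆} :
          Set (MvPolynomial (Fin 4) ℂ)))) ∧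
    LinearIndependent ℂ ![f₀, f₁, f₂, f₃, f₄, f₅, f₆] ∧
    Module.finrank ℂ (Submodule.span ℂ ({f₀, f₁, f₂, f₃, f₄, f₅, f₆} :
      Set (MvPolynomial (Fin 4) ℂ))) = 7 := by
  have hr : ({f₀, f₁, f₂, f₃, f₄, f₅, f₆} : Set (MvPolynomial (Fin 4) ℂ)) =
      Set.range ![f₀, f₁, f₂, f₃, f₄, f₅, f₆] := by
    ext x
    simp
    tauto
  refine ⟨?_, lin_indep, ?_⟩
  · intro q hq
    constructor
    · rintro ⟨d1, d2, d3⟩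
      have hE := quad_expand q hq
      have h0 := const_of_hom q hq
      choose c hc using h0
      have hs : ∀ i j, c i j = c j i := fun i j => by
        have := pderiv_swap q i j
        rw [hc, hc] at this
        exact C_injective _ _ this
      simp only [Δ₁, Δ₂, Δ₃, hc, smul_eq_C_mul, ← C_mul, ← C_sub, C_eq_zero] at d1 d2 d3
      have k1 : c 2 2 = 2 * c 0 1 := by linear_combination -2 * d1
      have k2 : c 3 3 = 2 * c 0 2 := by linear_combination -2 * d2
      have k3 : c 1 1 = 2 * c 0 3 := by linear_combination -2 * d3
      have key : q = (c 0 0 / 2) • f₀ + c 2 3 • f₁ + c 1 3 • f₂ + c 1 2 • f₃ + c 0 3 • f₄ +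
          c 0 1 • f₅ + c 0 2 • f₆ := by
        have hh : C (1/2 : ℂ) * C 2 = (1 : MvPolynomial (Fin 4) ℂ) := by
          rw [← C_mul]; norm_num
        have hE2 : q = C (1/2 : ℂ) * (C 2 * q) := by rw [← mul_assoc, hh, one_mul]
        rw [hE2, hE]
        simp only [Fin.sum_univ_four, hc, k1, k2, k3, hs 1 0, hs 2 0, hs 3 0, hs 2 1, hs 3 1,
          hs 3 2, smul_eq_C_mul, f₀, f₁, f₂, f₃, f₄, f₅, f₆, div_eq_mul_inv, one_mul, C_mul]
        rw [div_eq_mul_inv, one_mul] at hh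
        generalize (C (2⁻¹ : ℂ) : MvPolynomial (Fin 4) ℂ) = w at *
        have h2 : (C 2 : MvPolynomial (Fin 4) ℂ) = 2 := map_ofNat C 2
        rw [h2] at hh ⊢
        linear_combination (C (c 2 3) * (X 2 * X 3) + C (c 1 3) * (X 3 * X 1)
          + C (c 1 2) * (X 1 * X 2) + C (c 0 3) * (X 0 * X 3 + X 1 ^ 2)
          + C (c 0 1) * (X 0 * X 1 + X 2 ^ 2) + C (c 0 2) * (X 0 * X 2 + X 3 ^ 2)) * hh
      rw [key]
      repeat' apply Submodule.add_mem
      all_goals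
        apply Submodule.smul_mem
        apply Submodule.subset_span
        simp
    · intro h
      clear hq
      induction h using Submodule.span_induction with
      | mem x hx =>
        simp only [Set.mem_insert_iff, Set.mem_singleton_iff] at hx
        have hp : ∀ i, pderiv i (2 : MvPolynomial (Fin 4) ℂ) = 0 := fun i => by
          rw [← map_ofNat C 2, pderiv_C]
        have hw : (C (2⁻¹ : ℂ) : MvPolynomial (Fin 4) ℂ) * 2 = 1 := by
          rw [← map_ofNat C 2, ← C_mul]; norm_num
        rcases hx with rfl | rfl | rfl | rfl | rfl | rfl | rfl <;>
        simp [Δ₁, Δ₂, Δ₃, f₀, f₁, f₂, f₃, f₄, f₅, f₆, pderiv_X, Pi.single_apply,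
          smul_eq_C_mul, hw, hp, pow_two, ← two_mul]
      | zero => simp [Δ₁, Δ₂, Δ₃]
      | add x y _ _ hx hy =>
        obtain ⟨a1, a2, a3⟩ := hx
        obtain ⟨b1, b2, b3⟩ := hy
        simp only [Δ₁, Δ₂, Δ₃, map_add, smul_add] at *
        refine ⟨?_, ?_, ?_⟩
        · linear_combination a1 + b1
        · linear_combination a2 + b2
        · linear_combination a3 + b3
      | smul a x _ hx =>
        obtain ⟨a1, a2, a3⟩ := hx
        simp only [Δ₁, Δ₂, Δ₃, Derivation.map_smul, smul_eq_C_mul] at *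
        simp only [← smul_eq_C_mul, Derivation.map_smul] at *
        simp only [smul_eq_C_mul] at *
        refine ⟨?_, ?_, ?_⟩
        · linear_combination C a * a1
        · linear_combination C a * a2
        · linear_combination C a * a3
  · rw [hr, finrank_span_eq_card lin_indep]
    simp

end
end

section
/- Let α be a 3×2 matrix whose entries are homogeneous linear forms in S, let q₁, q₂, q₃ be its three 2×2 minors, and let I = (q₁, q₂, q₃) ⊆ S. If q₁, q₂, q₃ are linearly independent over ℂ and each qᵢ lies in J, then q₁, q₂, q₃ have no common non-constant factor and for every n ≥ 0 the degree-n homogeneous component of S/I has ℂ-dimension 3n + 1 (so S/I is the homogeneous coordinate ring of a projectively Cohen–Macaulay curve of degree 3 and arithmetic genus 0 in ℙ³). -/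
noncomputable section

open MvPolynomial

/-- The ideal J generated by the seven quadrics. -/
noncomputable def J : Ideal (MvPolynomial (Fin 4) ℂ) :=
  Ideal.span {f₀, f₁, f₂, f₃, f₄, f₅, f₆}

abbrev SS := MvPolynomial (Fin 4) ℂ

attribute [local instance] MvPolynomial.gradedAlgebra in
theorem hb_comp_mul {i : ℕ} {q : SS} (hq : q.IsHomogeneous i) (g : SS) (m : ℕ) :
    homogeneousComponent (m + i) (g * q) = homogeneousComponent m g * q := by
  have := DirectSum.coe_decompose_mul_of_right_mem_of_le (homogeneousSubmodule (Fin 4) ℂ)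
    (a := g) (b := q) (n := m + i) (i := i) hq (by omega)
  rw [Nat.add_sub_cancel] at this
  have h := decomposition.decompose'_apply (σ := Fin 4) (R := ℂ)
  rw [← h, ← h]
  exact this

attribute [local instance] MvPolynomial.gradedAlgebra in
theorem hb_comp_mul_lt {i : ℕ} {q : SS} (hq : q.IsHomogeneous i) (g : SS) (n : ℕ) (hn : n < i) :
    homogeneousComponent n (g * q) = 0 := by
  have := DirectSum.coe_decompose_mul_of_right_mem_of_not_le (homogeneousSubmodule (Fin 4) ℂ)
    (a := g) (b := q) (n := n) (i := i) hq (by omega)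
  have h := decomposition.decompose'_apply (σ := Fin 4) (R := ℂ)
  rw [← h]
  exact this

theorem hb_finrank (n : ℕ) :
    Module.finrank ℂ (homogeneousSubmodule (Fin 4) ℂ n) = (n + 3).choose 3 := by
  classical
  rw [homogeneousSubmodule_eq_finsupp_supported]
  have hs : {d : Fin 4 →₀ ℕ | d.degree = n} = ↑(Finset.finsuppAntidiag (Finset.univ : Finset (Fin 4)) n) := by
    ext d
    simp [Finset.mem_finsuppAntidiag, Finsupp.degree_eq_sum]
  rw [hs, (AddMonoidAlgebra.supportedEquivFinsupp (R := ℂ) (S := ℂ) _).finrank_eq,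
    Module.finrank_finsupp_self]
  simp only [Finset.coe_sort_coe, Fintype.card_coe, Finset.card_finsuppAntidiag_nat_eq_choose,
    Finset.card_univ, Fintype.card_fin]
  rw [show 4 + n - 1 = n + 3 by omega, Nat.choose_symm_add]

instance (n : ℕ) : Module.Finite ℂ (homogeneousSubmodule (Fin 4) ℂ n) :=
  Module.Finite.iff_fg.mpr (homogeneousSubmodule_fg _ _ n)

theorem hb_linear {p : SS} (hp : p.IsHomogeneous 1) : ∃ a : Fin 4 → ℂ, p = ∑ i, C (a i) * X i := by
  have : p ∈ homogeneousSubmodule (Fin 4) ℂ 1 := hp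
  rw [homogeneousSubmodule_one_eq_span_X, Submodule.mem_span_range_iff_exists_fun] at this
  obtain ⟨c, hc⟩ := this
  exact ⟨c, by simp [← hc, smul_eq_C_mul]⟩

theorem hb_two (x y : Fin 3 → ℂ) : ∃ c : Fin 3 → ℂ, c ≠ 0 ∧ ∑ i, c i * x i = 0 ∧ ∑ i, c i * y i = 0 := by
  let F : (Fin 3 → ℂ) →ₗ[ℂ] (Fin 2 → ℂ) := Matrix.toLin' !![x 0, x 1, x 2; y 0, y 1, y 2]
  have hF : LinearMap.ker F ≠ ⊥ := F.ker_ne_bot_of_finrank_lt (by simp)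
  obtain ⟨c, hc, hc0⟩ := Submodule.exists_mem_ne_zero_of_ne_bot hF
  refine ⟨c, hc0, ?_, ?_⟩
  · have := congrFun hc 0
    simp [F, Matrix.mulVec, dotProduct, Fin.sum_univ_three] at this ⊢
    linear_combination this
  · have := congrFun hc 1
    simp [F, Matrix.mulVec, dotProduct, Fin.sum_univ_three] at this ⊢
    linear_combination this

/-- Second derivative at the origin. -/
def dd (i j : Fin 4) (p : SS) : ℂ := eval 0 (pderiv i (pderiv j p))

theorem dd_add (i j p q) : dd i j (p + q) = dd i j p + dd i j q := by simp [dd]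

theorem dd_mul (i j : Fin 4) (p q : SS) : dd i j (p * q) =
   eval 0 p * dd i j q + eval 0 (pderiv i p) * eval 0 (pderiv j q)
   + eval 0 (pderiv j p) * eval 0 (pderiv i q) + dd i j p * eval 0 q := by
  simp [dd, Derivation.leibniz]; ring

theorem hb_J {p : SS} (hp : p ∈ J) : 2 * dd 0 1 p = dd 2 2 p ∧ 2 * dd 0 2 p = dd 3 3 p ∧
    2 * dd 0 3 p = dd 1 1 p := by
  have key : (2 * dd 0 1 p = dd 2 2 p ∧ 2 * dd 0 2 p = dd 3 3 p ∧
    2 * dd 0 3 p = dd 1 1 p) ∧ eval 0 p = 0 ∧ ∀ i, eval 0 (pderiv i p) = 0 := by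
    refine Submodule.span_induction (p := fun p _ => (2 * dd 0 1 p = dd 2 2 p ∧
      2 * dd 0 2 p = dd 3 3 p ∧
      2 * dd 0 3 p = dd 1 1 p) ∧ eval 0 p = 0 ∧ ∀ i, eval 0 (pderiv i p) = 0) ?_ ?_ ?_ ?_ hp
    · intro x hx
      simp only [Set.mem_insert_iff, Set.mem_singleton_iff] at hx
      rcases hx with rfl | rfl | rfl | rfl | rfl | rfl | rfl <;>
        simp [dd, f₀, f₁, f₂, f₃, f₄, f₅, f₆, pderiv_X, Pi.single_apply, pow_two]
      all_goals (try refine ⟨by norm_num, ?_⟩)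
      all_goals (intro i; fin_cases i <;> simp)
    · simp [dd]
    · intro x y _ _ h1 h2
      simp only [dd_add, map_add]
      grind
    · intro a x _ h
      simp only [smul_eq_mul, dd_mul, h.2.1, h.2.2, Derivation.leibniz, map_add, map_mul]
      grind
  exact key.1

theorem hb_dd (a b : Fin 4 → ℂ) (i j : Fin 4) :
    dd i j ((∑ k, C (a k) * X k) * (∑ k, C (b k) * X k)) = a i * b j + a j * b i := by
  rw [dd_mul]
  simp [Derivation.leibniz, pderiv_X, Pi.single_apply]

theorem hb_kernel (a : Fin 4 → ℂ) (ha : a ≠ 0) : ∃ s t : Fin 4, ∀ b : Fin 4 → ℂ,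
    a 0 * b 1 + a 1 * b 0 = a 2 * b 2 → a 0 * b 2 + a 2 * b 0 = a 3 * b 3 →
    a 0 * b 3 + a 3 * b 0 = a 1 * b 1 → b s = 0 → b t = 0 → b = 0 := by
  by_cases h0 : a 0 = 0
  · by_cases h1 : a 1 = 0
    · by_cases h2 : a 2 = 0
      · have h3 : a 3 ≠ 0 := by
          intro h3; apply ha; funext i; fin_cases i <;> simp [*]
        refine ⟨1, 2, fun b e1 e2 e3 u v => ?_⟩
        have : b 0 = 0 := by grind
        have : b 3 = 0 := by grind
        funext i; fin_cases i <;> simp [*]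
      · refine ⟨1, 3, fun b e1 e2 e3 u v => ?_⟩
        have : b 0 = 0 := by grind
        have : b 2 = 0 := by grind
        funext i; fin_cases i <;> simp [*]
    · refine ⟨2, 3, fun b e1 e2 e3 u v => ?_⟩
      have : b 0 = 0 := by grind
      have : b 1 = 0 := by grind
      funext i; fin_cases i <;> simp [*]
  · refine ⟨0, 3, fun b e1 e2 e3 u v => ?_⟩
    have : b 2 = 0 := by grind
    have : b 1 = 0 := by grind
    funext i; fin_cases i <;> simp [*]

theorem hb_nofac (q : Fin 3 → SS) (hq : LinearIndependent ℂ q) (hJ : ∀ i, q i ∈ J)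
    (D : SS) (L : Fin 3 → SS) (hD : D.IsHomogeneous 1) (hL : ∀ i, (L i).IsHomogeneous 1)
    (h : ∀ i, q i = D * L i) : False := by
  obtain ⟨a, rfl⟩ := hb_linear hD
  choose b hb using fun i => hb_linear (hL i)
  have ha : a ≠ 0 := by
    rintro rfl
    exact hq.ne_zero 0 (by simp [h])
  obtain ⟨s, t, hst⟩ := hb_kernel a ha
  obtain ⟨c, hc, hs, ht⟩ := hb_two (fun i => b i s) (fun i => b i t)
  have hB := hst (fun k => ∑ i, c i * b i k)
  have hE : ∀ i, _ := fun i => hb_J (hJ i)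
  simp only [h, hb, hb_dd] at hE
  have hB0 := hB (by
      simp only [Finset.mul_sum, ← Finset.sum_add_distrib]
      refine Finset.sum_congr rfl fun i _ => ?_
      linear_combination c i / 2 * (hE i).1) (by
      simp only [Finset.mul_sum, ← Finset.sum_add_distrib]
      refine Finset.sum_congr rfl fun i _ => ?_
      linear_combination c i / 2 * (hE i).2.1) (by
      simp only [Finset.mul_sum, ← Finset.sum_add_distrib]
      refine Finset.sum_congr rfl fun i _ => ?_
      linear_combination c i / 2 * (hE i).2.2) hs ht
  apply hc
  have := Fintype.linearIndependent_iff.mp hq c ?_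
  · funext i; exact this i
  have e : ∑ i, c i • q i = (∑ k, C (a k) * X k) * ∑ k, C (∑ i, c i * b i k) * X k := by
    simp only [h, hb, smul_eq_C_mul, map_sum, map_mul]
    simp only [Fin.sum_univ_three, Fin.sum_univ_four]
    ring
  rw [e]
  have : ∀ k, ∑ i, c i * b i k = 0 := fun k => congrFun hB0 k
  simp [this]

theorem hb_gcd (q : Fin 3 → SS) (hq : LinearIndependent ℂ q) (hJ : ∀ i, q i ∈ J)
    (hh : ∀ i, (q i).IsHomogeneous 2) (d : SS) (hd : ∀ i, d ∣ q i) : IsUnit d := by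
  choose L hL using hd
  have hq0 : ∀ i, q i ≠ 0 := hq.ne_zero
  have hd0 : d ≠ 0 := by rintro rfl; exact hq0 0 (by simp [hL])
  have hL0 : ∀ i, L i ≠ 0 := by intro i h; exact hq0 i (by simp [hL, h])
  have hdeg : ∀ i, d.totalDegree + (L i).totalDegree = 2 := by
    intro i
    rw [← totalDegree_mul_of_isDomain hd0 (hL0 i), ← hL, (hh i).totalDegree (hq0 i)]
  have hcase : d.totalDegree = 0 ∨ d.totalDegree = 1 ∨ d.totalDegree = 2 := by
    have := hdeg 0; omega
  rcases hcase with h | h | h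
  · rw [totalDegree_eq_zero_iff_eq_C] at h
    rw [h] at hd0 ⊢
    exact (isUnit_iff_ne_zero.mpr (by rintro h; simp [h] at hd0)).map C
  · exfalso
    refine hb_nofac q hq hJ (homogeneousComponent 1 d) (fun i => homogeneousComponent 1 (L i))
      (homogeneousComponent_isHomogeneous _ _) (fun i => homogeneousComponent_isHomogeneous _ _) ?_
    intro i
    have hl : (L i).totalDegree = 1 := by have := hdeg i; omega
    have split : ∀ p : SS, p.totalDegree = 1 → p = homogeneousComponent 0 p + homogeneousComponent 1 p := by
      intro p hp
      conv_lhs => rw [← sum_homogeneousComponent p, hp]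
      simp [Finset.sum_range_succ]
    have e1 : q i = homogeneousComponent 2 (q i) := by
      rw [homogeneousComponent_of_mem (hh i)]; simp
    rw [e1, hL]
    conv_lhs => rw [split (L i) hl, mul_add, map_add]
    rw [hb_comp_mul (i := 0) (m := 2) (homogeneousComponent_isHomogeneous _ _),
      hb_comp_mul (i := 1) (m := 1) (homogeneousComponent_isHomogeneous _ _),
      homogeneousComponent_eq_zero 2 d (by omega)]
    simp
  · exfalso
    have hl : ∀ i, ∃ c : ℂ, L i = C c := fun i =>
      ⟨_, totalDegree_eq_zero_iff_eq_C.mp (by have := hdeg i; omega)⟩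
    choose c hc using hl
    have h0 := Fintype.linearIndependent_iff.mp hq ![c 1, - c 0, 0] (by
      simp [Fin.sum_univ_three, hL, hc, smul_eq_C_mul]; ring) 0
    apply hL0 1
    simp at h0
    simp [hc, h0]

theorem hb_dvd {q₁ q₂ q₃ c : SS}
    (hg : ∀ d : SS, d ∣ q₁ → d ∣ q₂ → d ∣ q₃ → IsUnit d)
    (h2 : q₁ ∣ q₂ * c) (h3 : q₁ ∣ q₃ * c) : q₁ ∣ c := by
  classical
  let _ : GCDMonoid SS := UniqueFactorizationMonoid.toGCDMonoid SS
  have hu : IsUnit (gcd q₁ (gcd q₂ q₃)) := hg _ (gcd_dvd_left _ _)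
    ((gcd_dvd_right _ _).trans (gcd_dvd_left _ _)) ((gcd_dvd_right _ _).trans (gcd_dvd_right _ _))
  have h1 : q₁ ∣ gcd (q₁ * c) (gcd (q₂ * c) (q₃ * c)) :=
    dvd_gcd (dvd_mul_right _ _) (dvd_gcd h2 h3)
  have e : Associated (gcd (q₁ * c) (gcd (q₂ * c) (q₃ * c))) (gcd q₁ (gcd q₂ q₃) * c) :=
    ((Associated.refl _).gcd (gcd_mul_right' c q₂ q₃)).trans (gcd_mul_right' c q₁ _)
  exact (hu.dvd_mul_left).mp (h1.trans e.dvd)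

theorem hb_middle (α : Fin 3 → Fin 2 → SS) {q₁ q₂ q₃ : SS}
    (hq₁ : q₁ = α 0 0 * α 1 1 - α 0 1 * α 1 0)
    (hq₂ : q₂ = α 0 0 * α 2 1 - α 0 1 * α 2 0)
    (hq₃ : q₃ = α 1 0 * α 2 1 - α 1 1 * α 2 0)
    (h0 : q₁ ≠ 0)
    (hg : ∀ d : SS, d ∣ q₁ → d ∣ q₂ → d ∣ q₃ → IsUnit d) (g₀ g₁ g₂ : SS)
    (h : g₀ * q₃ - g₁ * q₂ + g₂ * q₁ = 0) :
    ∃ x y : SS, g₀ = x * α 0 0 + y * α 0 1 ∧ g₁ = x * α 1 0 + y * α 1 1 ∧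
      g₂ = x * α 2 0 + y * α 2 1 := by
  obtain ⟨x, hx⟩ : q₁ ∣ α 1 1 * g₀ - α 0 1 * g₁ := by
    refine hb_dvd hg ⟨α 2 1 * g₀ - α 0 1 * g₂, ?_⟩ ⟨α 2 1 * g₁ - α 1 1 * g₂, ?_⟩
    · subst hq₁ hq₂ hq₃; linear_combination α 0 1 * h
    · subst hq₁ hq₂ hq₃; linear_combination α 1 1 * h
  obtain ⟨y, hy⟩ : q₁ ∣ α 0 0 * g₁ - α 1 0 * g₀ := by
    refine hb_dvd hg ⟨α 0 0 * g₂ - α 2 0 * g₀, ?_⟩ ⟨α 1 0 * g₂ - α 2 0 * g₁, ?_⟩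
    · subst hq₁ hq₂ hq₃; linear_combination - α 0 0 * h
    · subst hq₁ hq₂ hq₃; linear_combination - α 1 0 * h
  refine ⟨x, y, mul_left_cancel₀ h0 ?_, mul_left_cancel₀ h0 ?_, mul_left_cancel₀ h0 ?_⟩
  · linear_combination α 0 0 * hx + α 0 1 * hy + g₀ * hq₁
  · linear_combination α 1 0 * hx + α 1 1 * hy + g₁ * hq₁
  · linear_combination α 2 0 * hx + α 2 1 * hy + h - g₀ * hq₃ + g₁ * hq₂

theorem hb_inj (α : Fin 3 → Fin 2 → SS) {q₁ : SS}
    (hq₁ : q₁ = α 0 0 * α 1 1 - α 0 1 * α 1 0) (h0 : q₁ ≠ 0) (x y : SS)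
    (h1 : x * α 0 0 + y * α 0 1 = 0) (h2 : x * α 1 0 + y * α 1 1 = 0) : x = 0 ∧ y = 0 := by
  constructor
  · apply mul_left_cancel₀ h0
    linear_combination x * hq₁ + α 1 1 * h1 - α 0 1 * h2
  · apply mul_left_cancel₀ h0
    linear_combination y * hq₁ + α 0 0 * h2 - α 1 0 * h1

abbrev HS (n : ℕ) := homogeneousSubmodule (Fin 4) ℂ n

/-- multiplication by `q` on forms of degree `n` -/
def mulMap (n : ℕ) (q : SS) : HS n →ₗ[ℂ] SS := (LinearMap.mulRight ℂ q).comp (HS n).subtype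

@[simp] theorem mulMap_apply (n q x) : mulMap n q x = (x : SS) * q := rfl

def Phi (m : ℕ) (q₁ q₂ q₃ : SS) : (HS m × HS m × HS m) →ₗ[ℂ] SS :=
  (mulMap m q₃).coprod ((mulMap m (-q₂)).coprod (mulMap m q₁))

def Psi (k : ℕ) (α : Fin 3 → Fin 2 → SS) : (HS k × HS k) →ₗ[ℂ] SS × SS × SS :=
  ((mulMap k (α 0 0)).coprod (mulMap k (α 0 1))).prod
   (((mulMap k (α 1 0)).coprod (mulMap k (α 1 1))).prod
    ((mulMap k (α 2 0)).coprod (mulMap k (α 2 1))))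

def Inc (m : ℕ) : (HS m × HS m × HS m) →ₗ[ℂ] SS × SS × SS :=
  (HS m).subtype.prodMap ((HS m).subtype.prodMap (HS m).subtype)

theorem Inc_inj (m : ℕ) : Function.Injective (Inc m) := by
  rintro ⟨a, b, c⟩ ⟨a', b', c'⟩ h
  simpa [Inc] using h

theorem Phi_apply (m q₁ q₂ q₃ x) : Phi m q₁ q₂ q₃ x =
    (x.1 : SS) * q₃ - (x.2.1 : SS) * q₂ + (x.2.2 : SS) * q₁ := by
  simp [Phi]; ring

theorem hb_quot (I : Ideal SS) (n : ℕ) (N : Submodule ℂ SS)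
    (hN : ∀ p, p ∈ N ↔ p ∈ I ∧ p.IsHomogeneous n) :
    Module.finrank ℂ (Submodule.map (Ideal.Quotient.mkₐ ℂ I).toLinearMap
        (homogeneousSubmodule (Fin 4) ℂ n))
      + Module.finrank ℂ N = (n + 3).choose 3 := by
  rw [← hb_finrank]
  let F := (Ideal.Quotient.mkₐ ℂ I).toLinearMap.domRestrict (HS n)
  have h1 := F.finrank_range_add_finrank_ker
  have h2 : LinearMap.range F = Submodule.map (Ideal.Quotient.mkₐ ℂ I).toLinearMap (HS n) := by
    rw [LinearMap.range_domRestrict]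
  have h3 : Submodule.map (HS n).subtype (LinearMap.ker F) = N := by
    ext p
    simp only [Submodule.mem_map, hN, LinearMap.mem_ker]
    constructor
    · rintro ⟨x, hx, rfl⟩
      exact ⟨Ideal.Quotient.eq_zero_iff_mem.mp hx, x.2⟩
    · rintro ⟨h, hp⟩
      exact ⟨⟨p, hp⟩, Ideal.Quotient.eq_zero_iff_mem.mpr h, rfl⟩
  rw [← h2, ← h3, Submodule.finrank_map_subtype_eq, h1]

theorem hb_range {q₁ q₂ q₃ : SS} (h1 : q₁.IsHomogeneous 2) (h2 : q₂.IsHomogeneous 2)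
    (h3 : q₃.IsHomogeneous 2) (m : ℕ) (p : SS) : p ∈ LinearMap.range (Phi m q₁ q₂ q₃) ↔
    p ∈ Ideal.span {q₁, q₂, q₃} ∧ p.IsHomogeneous (m + 2) := by
  simp only [LinearMap.mem_range, Phi_apply, Ideal.mem_span_insert, Ideal.mem_span_singleton']
  constructor
  · rintro ⟨⟨a, b, c⟩, rfl⟩
    refine ⟨⟨c, _, ⟨-b, _, ⟨a, rfl⟩, rfl⟩, by ring⟩, ?_⟩
    exact ((IsHomogeneous.mul a.2 h3).sub (IsHomogeneous.mul b.2 h2)).add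
      (IsHomogeneous.mul c.2 h1)
  · rintro ⟨⟨c, _, ⟨b, _, ⟨a, rfl⟩, rfl⟩, rfl⟩, hp⟩
    refine ⟨⟨⟨homogeneousComponent m a, homogeneousComponent_mem _ _⟩,
      ⟨-homogeneousComponent m b, neg_mem (homogeneousComponent_mem _ _)⟩,
      ⟨homogeneousComponent m c, homogeneousComponent_mem _ _⟩⟩, ?_⟩
    rw [← homogeneousComponent_eq_self hp]
    simp only [map_add, hb_comp_mul h1, hb_comp_mul h2, hb_comp_mul h3]
    ring

theorem hb_low {q₁ q₂ q₃ : SS} (h1 : q₁.IsHomogeneous 2) (h2 : q₂.IsHomogeneous 2)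
    (h3 : q₃.IsHomogeneous 2) (n : ℕ) (hn : n < 2) (p : SS) : p ∈ (⊥ : Submodule ℂ SS) ↔
    p ∈ Ideal.span {q₁, q₂, q₃} ∧ p.IsHomogeneous n := by
  simp only [Submodule.mem_bot, Ideal.mem_span_insert, Ideal.mem_span_singleton']
  constructor
  · rintro rfl
    exact ⟨⟨0, 0, ⟨0, 0, ⟨0, by simp⟩, by simp⟩, by simp⟩, isHomogeneous_zero _ _ _⟩
  · rintro ⟨⟨c, _, ⟨b, _, ⟨a, rfl⟩, rfl⟩, rfl⟩, hp⟩
    rw [← homogeneousComponent_eq_self hp]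
    simp only [map_add, hb_comp_mul_lt h1 _ n hn, hb_comp_mul_lt h2 _ n hn,
      hb_comp_mul_lt h3 _ n hn, add_zero]

theorem hb_ker (α : Fin 3 → Fin 2 → SS) {q₁ q₂ q₃ : SS}
    (hlin : ∀ i j, (α i j).IsHomogeneous 1)
    (hq₁ : q₁ = α 0 0 * α 1 1 - α 0 1 * α 1 0)
    (hq₂ : q₂ = α 0 0 * α 2 1 - α 0 1 * α 2 0)
    (hq₃ : q₃ = α 1 0 * α 2 1 - α 1 1 * α 2 0)
    (h0 : q₁ ≠ 0)
    (hg : ∀ d : SS, d ∣ q₁ → d ∣ q₂ → d ∣ q₃ → IsUnit d) (k : ℕ) :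
    Module.finrank ℂ (LinearMap.ker (Phi (k + 1) q₁ q₂ q₃)) = 2 * (k + 3).choose 3 := by
  have hinj : Function.Injective (Psi k α) := by
    rw [← LinearMap.ker_eq_bot, LinearMap.ker_eq_bot']
    rintro ⟨x, y⟩ h
    simp only [Psi, LinearMap.prod_apply, Function.prod, LinearMap.coprod_apply, mulMap_apply,
      Prod.mk_eq_zero] at h
    obtain ⟨hx, hy⟩ := hb_inj α hq₁ h0 x y h.1 h.2.1
    ext1 <;> exact Subtype.ext (by assumption)
  have e : Submodule.map (Inc (k + 1)) (LinearMap.ker (Phi (k + 1) q₁ q₂ q₃)) =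
      LinearMap.range (Psi k α) := by
    ext p
    simp only [Submodule.mem_map, LinearMap.mem_ker, LinearMap.mem_range, Phi_apply]
    constructor
    · rintro ⟨⟨a, b, c⟩, h, rfl⟩
      obtain ⟨x, y, hx, hy, hz⟩ := hb_middle α hq₁ hq₂ hq₃ h0 hg a b c h
      refine ⟨⟨⟨homogeneousComponent k x, homogeneousComponent_mem _ _⟩,
        ⟨homogeneousComponent k y, homogeneousComponent_mem _ _⟩⟩, ?_⟩
      have ha := homogeneousComponent_eq_self a.2
      have hb := homogeneousComponent_eq_self b.2
      have hc := homogeneousComponent_eq_self c.2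
      rw [hx] at ha
      rw [hy] at hb
      rw [hz] at hc
      simp only [map_add, hb_comp_mul (hlin _ _)] at ha hb hc
      simp only [Psi, Inc, LinearMap.prod_apply, Function.prod, LinearMap.coprod_apply, mulMap_apply,
        LinearMap.prodMap_apply, Submodule.subtype_apply]
      rw [ha, hb, hc, hx, hy, hz]
    · rintro ⟨⟨x, y⟩, rfl⟩
      have hm : ∀ i, (x * α i 0 + y * α i 1 : SS) ∈ HS (k + 1) := fun i =>
        (IsHomogeneous.mul x.2 (hlin i 0)).add (IsHomogeneous.mul y.2 (hlin i 1))
      refine ⟨⟨⟨_, hm 0⟩, ⟨_, hm 1⟩, ⟨_, hm 2⟩⟩, ?_, rfl⟩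
      subst hq₁ hq₂ hq₃
      dsimp only
      ring
  rw [(Submodule.equivMapOfInjective _ (Inc_inj (k+1)) _).finrank_eq, e,
    LinearMap.finrank_range_of_inj hinj, Module.finrank_prod, hb_finrank]
  ring

theorem hb_choose (k : ℕ) :
    (k + 6).choose 3 + 2 * (k + 3).choose 3 = 3 * (k + 4).choose 3 + (3 * (k + 3) + 1) := by
  induction k with
  | zero => decide
  | succ k ih =>
    have a : ∀ n, (n + 1).choose 3 = n.choose 2 + n.choose 3 := fun n => Nat.choose_succ_succ n 2
    have b : ∀ n, (n + 1).choose 2 = n + n.choose 2 := fun n => by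
      rw [Nat.choose_succ_succ n 1, Nat.choose_one_right]
    have := a (k + 6); have := a (k + 3); have := a (k + 4)
    have := b (k + 5); have := b (k + 4); have := b (k + 3)
    rw [show k + 1 + 6 = k + 6 + 1 by ring, show k + 1 + 3 = k + 3 + 1 by ring,
      show k + 1 + 4 = k + 4 + 1 by ring]
    simp only [Nat.add_assoc, Nat.reduceAdd] at *
    omega

/-- if the three 2×2 minors q₁, q₂, q₃ of a 3×2 matrix α of
linear forms are linearly independent and lie in J, then they have no common
non-constant factor and the homogeneous coordinate ring S/(q₁,q₂,q₃) has
Hilbert function n ↦ 3n+1 (a projectively Cohen–Macaulay twisted cubic). -/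
theorem hilbert_burch_curve
    (α : Fin 3 → Fin 2 → MvPolynomial (Fin 4) ℂ)
    (hlin : ∀ i j, (α i j).IsHomogeneous 1)
    (q₁ q₂ q₃ : MvPolynomial (Fin 4) ℂ)
    (hq₁ : q₁ = α 0 0 * α 1 1 - α 0 1 * α 1 0)
    (hq₂ : q₂ = α 0 0 * α 2 1 - α 0 1 * α 2 0)
    (hq₃ : q₃ = α 1 0 * α 2 1 - α 1 1 * α 2 0)
    (hind : LinearIndependent ℂ ![q₁, q₂, q₃])
    (hJ : q₁ ∈ J ∧ q₂ ∈ J ∧ q₃ ∈ J) :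
    (∀ d : MvPolynomial (Fin 4) ℂ, d ∣ q₁ → d ∣ q₂ → d ∣ q₃ → IsUnit d) ∧
    (∀ n : ℕ,
      Module.finrank ℂ
        (Submodule.map
          (Ideal.Quotient.mkₐ ℂ (Ideal.span {q₁, q₂, q₃} :
            Ideal (MvPolynomial (Fin 4) ℂ))).toLinearMap
          (homogeneousSubmodule (Fin 4) ℂ n)) = 3 * n + 1) := by
  have hq : ∀ i, ![q₁, q₂, q₃] i ∈ J := by
    intro i; fin_cases i
    exacts [hJ.1, hJ.2.1, hJ.2.2]
  have h1 : q₁.IsHomogeneous 2 := by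
    rw [hq₁]; exact ((hlin _ _).mul (hlin _ _)).sub ((hlin _ _).mul (hlin _ _))
  have h2 : q₂.IsHomogeneous 2 := by
    rw [hq₂]; exact ((hlin _ _).mul (hlin _ _)).sub ((hlin _ _).mul (hlin _ _))
  have h3 : q₃.IsHomogeneous 2 := by
    rw [hq₃]; exact ((hlin _ _).mul (hlin _ _)).sub ((hlin _ _).mul (hlin _ _))
  have hh : ∀ i, (![q₁, q₂, q₃] i).IsHomogeneous 2 := by
    intro i; fin_cases i
    exacts [h1, h2, h3]
  have hg : ∀ d : MvPolynomial (Fin 4) ℂ, d ∣ q₁ → d ∣ q₂ → d ∣ q₃ → IsUnit d := by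
    intro d d1 d2 d3
    refine hb_gcd _ hind hq hh d ?_
    intro i; fin_cases i
    exacts [d1, d2, d3]
  have h0 : q₁ ≠ 0 := hind.ne_zero 0
  refine ⟨hg, fun n => ?_⟩
  by_cases hn : n < 2
  · have := hb_quot _ n _ (hb_low h1 h2 h3 n hn)
    rw [finrank_bot] at this
    interval_cases n <;> simpa using this
  obtain ⟨m, rfl⟩ : ∃ m, n = m + 2 := ⟨n - 2, by omega⟩
  have hA := hb_quot _ (m + 2) _ (hb_range h1 h2 h3 m)
  have hB := (Phi m q₁ q₂ q₃).finrank_range_add_finrank_ker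
  rw [Module.finrank_prod, Module.finrank_prod, hb_finrank] at hB
  rcases m with _ | k
  · have hK : LinearMap.ker (Phi 0 q₁ q₂ q₃) = ⊥ := by
      rw [LinearMap.ker_eq_bot']
      rintro ⟨a, b, c⟩ h
      rw [Phi_apply] at h
      dsimp only at h
      have hC : ∀ a : HS 0, ∃ r : ℂ, (a : SS) = C r := fun a =>
        ⟨_, totalDegree_eq_zero_iff_eq_C.mp (Nat.le_zero.mp (IsHomogeneous.totalDegree_le a.2))⟩
      obtain ⟨r, hr⟩ := hC a
      obtain ⟨s, hs⟩ := hC b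
      obtain ⟨t, ht⟩ := hC c
      have hz := Fintype.linearIndependent_iff.mp hind ![t, -s, r] (by
        rw [hr, hs, ht] at h
        simp [Fin.sum_univ_three, smul_eq_C_mul]
        linear_combination h)
      have z0 : t = 0 := hz 0
      have z1 : -s = 0 := hz 1
      have z2 : r = 0 := hz 2
      rw [neg_eq_zero] at z1
      have e1 : a = 0 := Subtype.ext (by simp [hr, z2])
      have e2 : b = 0 := Subtype.ext (by simp [hs, z1])
      have e3 : c = 0 := Subtype.ext (by simp [ht, z0])
      rw [e1, e2, e3]; rfl
    rw [hK, finrank_bot] at hB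
    have hfin : ∀ a b : ℕ, a + b = Nat.choose 5 3 → b + 0 = Nat.choose 3 3 + (Nat.choose 3 3
        + Nat.choose 3 3) → a = 7 := by
      intro a b
      rw [show Nat.choose 5 3 = 10 by decide, Nat.choose_self]
      omega
    exact hfin _ _ hA hB
  · rw [hb_ker α hlin hq₁ hq₂ hq₃ h0 hg k] at hB
    have := hb_choose k
    have hfin : ∀ a b : ℕ, a + b = (k + 6).choose 3 → b + 2 * (k + 3).choose 3 =
        (k + 4).choose 3 + ((k + 4).choose 3 + (k + 4).choose 3) → a = 3 * (k + 3) + 1 := by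
      intro a b
      omega
    exact hfin _ _ hA hB

end
end

section
/- For all k, ℓ ∈ ℤ/7ℤ and every vector v = Σ_j x_j e_j ∈ ℂ⁷, one has u₀(k) ∧ u₃(ℓ) ∧ v = u₃(k) ∧ u₀(ℓ) ∧ v = −u₁(k) ∧ u₁(ℓ) ∧ v = B₃(x)_{k,ℓ} · (e₀∧e₁∧e₂∧e₃∧e₄∧e₅∧e₆) in Λ⁷ℂ⁷, where B₃(x)_{k,ℓ} = x_{2+k} if ℓ = k+4, B₃(x)_{k,ℓ} = −x_{5+k} if ℓ = k+3, and B₃(x)_{k,ℓ} = 0 otherwise. -/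
noncomputable section

/-- The image in the exterior algebra of the standard basis vector `e_j` of ℂ⁷. -/
noncomputable def e (j : ZMod 7) : ExteriorAlgebra ℂ (ZMod 7 → ℂ) :=
  ExteriorAlgebra.ι ℂ (Pi.single j 1)

/-- u₀(k) = e_{1+k}∧e_{4+k}∧e_{2+k} − e_{6+k}∧e_{3+k}∧e_{5+k}. -/
noncomputable def u₀ (k : ZMod 7) : ExteriorAlgebra ℂ (ZMod 7 → ℂ) :=
  e (1 + k) * e (4 + k) * e (2 + k) - e (6 + k) * e (3 + k) * e (5 + k)

/-- u₁(k) = e_k∧e_{1+k}∧e_{6+k}. -/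
noncomputable def u₁ (k : ZMod 7) : ExteriorAlgebra ℂ (ZMod 7 → ℂ) :=
  e k * e (1 + k) * e (6 + k)

/-- u₂(k) = e_k∧e_{2+k}∧e_{5+k}. -/
noncomputable def u₂ (k : ZMod 7) : ExteriorAlgebra ℂ (ZMod 7 → ℂ) :=
  e k * e (2 + k) * e (5 + k)

/-- u₃(k) = e_k∧e_{4+k}∧e_{3+k}. -/
noncomputable def u₃ (k : ZMod 7) : ExteriorAlgebra ℂ (ZMod 7 → ℂ) :=
  e k * e (4 + k) * e (3 + k)

/-- The generator e₀∧e₁∧e₂∧e₃∧e₄∧e₅∧e₆ of Λ⁷ℂ⁷. -/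
noncomputable def Etop : ExteriorAlgebra ℂ (ZMod 7 → ℂ) :=
  e 0 * e 1 * e 2 * e 3 * e 4 * e 5 * e 6

/-- B₃(x)_{k,ℓ} = x_{2+k} if ℓ = k+4, −x_{5+k} if ℓ = k+3, 0 otherwise. -/
noncomputable def B₃ (x : ZMod 7 → ℂ) (k l : ZMod 7) : ℂ :=
  if l = k + 4 then x (2 + k) else if l = k + 3 then -x (5 + k) else 0

/-- Insert `a` into a signed word, sorting by anticommutation. -/
def insWord (a : ZMod 7) : List (ZMod 7) → ℤ × List (ZMod 7)
  | [] => (1, [a])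
  | b :: t =>
    if a.val < b.val then (1, a :: b :: t)
    else if a = b then (0, [])
    else (-(insWord a t).1, b :: (insWord a t).2)

/-- Signed insertion sort of a word. -/
def sortWord : List (ZMod 7) → ℤ × List (ZMod 7)
  | [] => (1, [])
  | a :: t => ((sortWord t).1 * (insWord a (sortWord t).2).1, (insWord a (sortWord t).2).2)

/-- The product of the basis vectors of a word. -/
def wordProd (w : List (ZMod 7)) : ExteriorAlgebra ℂ (ZMod 7 → ℂ) := (w.map e).prod

lemma e_sq (a : ZMod 7) : e a * e a = 0 := ExteriorAlgebra.ι_sq_zero _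

lemma e_swap (a b : ZMod 7) : e a * e b = -(e b * e a) :=
  eq_neg_of_add_eq_zero_left (ExteriorAlgebra.ι_add_mul_swap _ _)

lemma insWord_spec (a : ZMod 7) (w : List (ZMod 7)) :
    e a * wordProd w = (insWord a w).1 • wordProd (insWord a w).2 := by
  induction w with
  | nil => simp [insWord, wordProd]
  | cons b t ih =>
    unfold insWord
    split_ifs with h1 h2
    · simp [wordProd]
    · subst h2
      simp [wordProd, ← mul_assoc, e_sq]
    · have h : wordProd (b :: t) = e b * wordProd t := by simp [wordProd]
      have h' : wordProd (b :: (insWord a t).2) = e b * wordProd (insWord a t).2 := by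
        simp [wordProd]
      rw [h, h', ← mul_assoc, e_swap, neg_mul, mul_assoc, ih, mul_smul_comm, neg_smul]

lemma sortWord_spec (w : List (ZMod 7)) :
    wordProd w = (sortWord w).1 • wordProd (sortWord w).2 := by
  induction w with
  | nil => simp [sortWord]
  | cons a t ih =>
    have h : wordProd (a :: t) = e a * wordProd t := by simp [wordProd]
    rw [h, ih, mul_smul_comm, insWord_spec, smul_smul]
    rfl

lemma wordProd_eq (w : List (ZMod 7)) (c : ℤ)
    (h : (c = 0 ∧ (sortWord w).1 = 0) ∨ sortWord w = (c, [0, 1, 2, 3, 4, 5, 6])) :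
    wordProd w = c • Etop := by
  rw [sortWord_spec]
  rcases h with ⟨h1, h2⟩ | h
  · simp [h1, h2]
  · rw [h]
    simp [wordProd, Etop, mul_assoc]

/-- The coefficient of `x_j` in `B₃(x)_{k,l}`. -/
def bCoef (k l j : ZMod 7) : ℤ :=
  if l = k + 4 then (if j = 2 + k then 1 else 0)
  else if l = k + 3 then (if j = 5 + k then -1 else 0) else 0

/-- The sign of a word that is a permutation of all indices, and zero otherwise. -/
def coefWord (w : List (ZMod 7)) : ℤ := (sortWord w).1

/-- Check that a word is degenerate or sorts to the full word. -/
def goodWord (w : List (ZMod 7)) : Prop :=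
  (sortWord w).1 = 0 ∨ (sortWord w).2 = [0, 1, 2, 3, 4, 5, 6]

instance (w : List (ZMod 7)) : Decidable (goodWord w) := by
  unfold goodWord
  infer_instance

lemma goodWord_eq (w : List (ZMod 7)) (h : goodWord w) : wordProd w = coefWord w • Etop := by
  apply wordProd_eq
  rcases h with h | h
  · exact Or.inl ⟨h, h⟩
  · exact Or.inr (Prod.ext rfl h)

lemma check_first : ∀ k l j : ZMod 7,
    goodWord [1 + k, 4 + k, 2 + k, l, 4 + l, 3 + l, j] ∧
    goodWord [6 + k, 3 + k, 5 + k, l, 4 + l, 3 + l, j] ∧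
    coefWord [1 + k, 4 + k, 2 + k, l, 4 + l, 3 + l, j] -
    coefWord [6 + k, 3 + k, 5 + k, l, 4 + l, 3 + l, j] = bCoef k l j := by
  decide +kernel

lemma check_second : ∀ k l j : ZMod 7,
    goodWord [k, 4 + k, 3 + k, 1 + l, 4 + l, 2 + l, j] ∧
    goodWord [k, 4 + k, 3 + k, 6 + l, 3 + l, 5 + l, j] ∧
    coefWord [k, 4 + k, 3 + k, 1 + l, 4 + l, 2 + l, j] -
    coefWord [k, 4 + k, 3 + k, 6 + l, 3 + l, 5 + l, j] = bCoef k l j := by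
  decide +kernel

lemma check_third : ∀ k l j : ZMod 7,
    goodWord [k, 1 + k, 6 + k, l, 1 + l, 6 + l, j] ∧
    -coefWord [k, 1 + k, 6 + k, l, 1 + l, 6 + l, j] = bCoef k l j := by
  decide +kernel

lemma first_e (k l j : ZMod 7) : u₀ k * u₃ l * e j = bCoef k l j • Etop := by
  obtain ⟨h1, h2, h3⟩ := check_first k l j
  rw [← h3, sub_smul, ← goodWord_eq _ h1, ← goodWord_eq _ h2]
  simp [wordProd, u₀, u₃, sub_mul, mul_assoc]

lemma second_e (k l j : ZMod 7) : u₃ k * u₀ l * e j = bCoef k l j • Etop := by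
  obtain ⟨h1, h2, h3⟩ := check_second k l j
  rw [← h3, sub_smul, ← goodWord_eq _ h1, ← goodWord_eq _ h2]
  simp [wordProd, u₀, u₃, sub_mul, mul_sub, mul_assoc]

lemma third_e (k l j : ZMod 7) : -(u₁ k * u₁ l) * e j = bCoef k l j • Etop := by
  obtain ⟨h1, h3⟩ := check_third k l j
  rw [← h3, neg_smul, ← goodWord_eq _ h1]
  simp [wordProd, u₁, mul_assoc]

lemma iota_sum (x : ZMod 7 → ℂ) : ExteriorAlgebra.ι ℂ x = ∑ j, x j • e j := by
  conv_lhs => rw [pi_eq_sum_univ' x]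
  simp only [map_sum, map_smul, e]

lemma B₃_sum (x : ZMod 7 → ℂ) (k l : ZMod 7) : B₃ x k l = ∑ j, x j * (bCoef k l j : ℂ) := by
  unfold B₃ bCoef
  split_ifs <;> simp

lemma extend_e (A : ExteriorAlgebra ℂ (ZMod 7 → ℂ)) (k l : ZMod 7) (x : ZMod 7 → ℂ)
    (h : ∀ j, A * e j = bCoef k l j • Etop) :
    A * ExteriorAlgebra.ι ℂ x = B₃ x k l • Etop := by
  rw [iota_sum, B₃_sum, Finset.mul_sum, Finset.sum_smul]
  refine Finset.sum_congr rfl fun j _ => ?_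
  rw [mul_smul_comm, h, mul_smul, Int.cast_smul_eq_zsmul]

/-- u₀(k)∧u₃(ℓ)∧v = u₃(k)∧u₀(ℓ)∧v = −u₁(k)∧u₁(ℓ)∧v
= B₃(x)_{k,ℓ}·(e₀∧⋯∧e₆) for v = Σ_j x_j e_j. -/
theorem wedge_product_B₃ (k l : ZMod 7) (x : ZMod 7 → ℂ) :
    u₀ k * u₃ l * ExteriorAlgebra.ι ℂ x = B₃ x k l • Etop ∧
    u₃ k * u₀ l * ExteriorAlgebra.ι ℂ x = B₃ x k l • Etop ∧
    -(u₁ k * u₁ l * ExteriorAlgebra.ι ℂ x) = B₃ x k l • Etop := by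
  refine ⟨extend_e _ k l x (first_e k l), extend_e _ k l x (second_e k l), ?_⟩
  rw [← neg_mul]
  exact extend_e _ k l x (third_e k l)

end
end
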